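/- arXiv:1302.6435 — 5 statements merged into one kernel-verified Lean document; each statement's English description precedes it below -/
import Mathlib

section
/- For all integers r, r' with 1 ≤ r, r' ≤ p₊−1 and all integers s, s' with 1 ≤ s, s' ≤ p₋−1, one has h_{r,s} = h_{r',s'} if and only if (r',s') = (r,s) or (r',s') = (p₊−r, p₋−s). In particular the conformal weights Δ_{r,s} attached to distinct classes of the Kac table (the quotient of {1,…,p₊−1}×{1,…,p₋−1} by (r,s) ∼ (p₊−r,p₋−s)) are pairwise distinct. -/
/-- `α₊ = √(2p₋/p₊)` regarded as a complex number. -/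
noncomputable def alphaP (pp pm : ℕ) : ℂ := ((Real.sqrt (2 * (pm : ℝ) / (pp : ℝ)) : ℝ) : ℂ)

/-- `α₋ = −√(2p₊/p₋)` regarded as a complex number. -/
noncomputable def alphaM (pp pm : ℕ) : ℂ := -((Real.sqrt (2 * (pp : ℝ) / (pm : ℝ)) : ℝ) : ℂ)

/-- `α₀ = α₊ + α₋`. -/
noncomputable def alpha0 (pp pm : ℕ) : ℂ := alphaP pp pm + alphaM pp pm

/-- The conformal weight `h_β = β(β − α₀)/2`. -/
noncomputable def hwt (pp pm : ℕ) (β : ℂ) : ℂ := β * (β - alpha0 pp pm) / 2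

/-- `β_{r,s} = ((1−r)/2)·α₊ + ((1−s)/2)·α₋`. -/
noncomputable def betaRS (pp pm : ℕ) (r s : ℤ) : ℂ :=
  (((1 - r : ℤ) : ℂ) / 2) * alphaP pp pm + (((1 - s : ℤ) : ℂ) / 2) * alphaM pp pm

/-- `h_{r,s} = h_{β_{r,s}}`. -/
noncomputable def hRS (pp pm : ℕ) (r s : ℤ) : ℂ := hwt pp pm (betaRS pp pm r s)

theorem alphaP_sq (pp pm : ℕ) : alphaP pp pm ^ 2 = 2 * (pm : ℂ) / pp := by
  have h : Real.sqrt (2 * (pm : ℝ) / pp) ^ 2 = 2 * pm / pp := Real.sq_sqrt (by positivity)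
  unfold alphaP
  rw [← Complex.ofReal_pow, h]
  push_cast
  rfl

theorem alphaM_sq (pp pm : ℕ) : alphaM pp pm ^ 2 = 2 * (pp : ℂ) / pm := by
  have h : Real.sqrt (2 * (pp : ℝ) / pm) ^ 2 = 2 * pp / pm := Real.sq_sqrt (by positivity)
  unfold alphaM
  rw [neg_sq]
  rw [← Complex.ofReal_pow, h]
  push_cast
  rfl

theorem alphaP_mul_alphaM {pp pm : ℕ} (hpp : pp ≠ 0) (hpm : pm ≠ 0) :
    alphaP pp pm * alphaM pp pm = -2 := by
  have hpp' : (pp : ℝ) ≠ 0 := by exact_mod_cast hpp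
  have hpm' : (pm : ℝ) ≠ 0 := by exact_mod_cast hpm
  have h : Real.sqrt (2 * (pm : ℝ) / pp) * Real.sqrt (2 * (pp : ℝ) / pm) = 2 := by
    rw [← Real.sqrt_mul (by positivity), Real.sqrt_eq_iff_mul_self_eq (by positivity) (by norm_num)]
    field_simp
  unfold alphaP alphaM
  rw [mul_neg, ← Complex.ofReal_mul, h]
  norm_num

/-- The explicit rational form of the conformal weights. -/
theorem hRS_eq {pp pm : ℕ} (hpp : pp ≠ 0) (hpm : pm ≠ 0) (r s : ℤ) :
    hRS pp pm r s =
      (((r * pm - s * pp : ℤ) : ℂ) ^ 2 - ((pm : ℂ) - pp) ^ 2) / (4 * pp * pm) := by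
  have hpp' : (pp : ℂ) ≠ 0 := by exact_mod_cast hpp
  have hpm' : (pm : ℂ) ≠ 0 := by exact_mod_cast hpm
  have hexp : hRS pp pm r s =
      (((r : ℂ) ^ 2 - 1) * alphaP pp pm ^ 2 + ((s : ℂ) ^ 2 - 1) * alphaM pp pm ^ 2
        + 2 * ((r : ℂ) * s - 1) * (alphaP pp pm * alphaM pp pm)) / 8 := by
    unfold hRS hwt betaRS alpha0
    push_cast
    ring
  rw [hexp, alphaP_sq, alphaM_sq, alphaP_mul_alphaM hpp hpm]
  push_cast
  field_simp
  ring

theorem hRS_eq_hRS_iff {pp pm : ℕ} (hpp : pp ≠ 0) (hpm : pm ≠ 0) (r r' s s' : ℤ) :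
    hRS pp pm r s = hRS pp pm r' s' ↔ (r * pm - s * pp) ^ 2 = (r' * pm - s' * pp) ^ 2 := by
  have h : (4 * pp * pm : ℂ) ≠ 0 := by
    simp [hpp, hpm]
  rw [hRS_eq hpp hpm, hRS_eq hpp hpm, div_left_inj' h, sub_left_inj]
  norm_cast

/-- For `1 ≤ r,r' ≤ p₊−1` and `1 ≤ s,s' ≤ p₋−1`,
`h_{r,s} = h_{r',s'}` iff `(r',s') = (r,s)` or `(r',s') = (p₊−r, p₋−s)`. -/
theorem kac_weights_eq_iff (pp pm : ℕ) (hpp : 2 ≤ pp) (hpm : 2 ≤ pm)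
    (hco : Nat.Coprime pp pm) (r r' s s' : ℤ)
    (hr1 : 1 ≤ r) (hr2 : r ≤ (pp : ℤ) - 1) (hr1' : 1 ≤ r') (hr2' : r' ≤ (pp : ℤ) - 1)
    (hs1 : 1 ≤ s) (hs2 : s ≤ (pm : ℤ) - 1) (hs1' : 1 ≤ s') (hs2' : s' ≤ (pm : ℤ) - 1) :
    hRS pp pm r s = hRS pp pm r' s' ↔
      (r' = r ∧ s' = s) ∨ (r' = (pp : ℤ) - r ∧ s' = (pm : ℤ) - s) := by
  have hpp0 : (0 : ℤ) < pp := by omega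
  have hpm0 : (0 : ℤ) < pm := by omega
  have hcop : IsCoprime (pp : ℤ) pm := Nat.isCoprime_iff_coprime.mpr hco
  rw [hRS_eq_hRS_iff (by omega) (by omega), sq_eq_sq_iff_eq_or_eq_neg]
  refine or_congr ⟨fun h => ?_, ?_⟩ ⟨fun h => ?_, ?_⟩
  · have hdvd : (pp : ℤ) ∣ r - r' :=
      hcop.dvd_of_dvd_mul_right ⟨s - s', by linear_combination h⟩
    have hr : r - r' = 0 := Int.eq_zero_of_abs_lt_dvd hdvd (by rw [abs_lt]; omega)
    have hs : (s' - s) * (pp : ℤ) = 0 := by linear_combination h - pm * hr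
    have := (mul_eq_zero.mp hs).resolve_right hpp0.ne'
    omega
  · rintro ⟨rfl, rfl⟩
    rfl
  · have hdvd : (pp : ℤ) ∣ r + r' - pp :=
      dvd_sub_self_right.mpr
        (hcop.dvd_of_dvd_mul_right ⟨s + s', by linear_combination h⟩)
    have hr : r + r' - pp = 0 := Int.eq_zero_of_abs_lt_dvd hdvd (by rw [abs_lt]; omega)
    have hs : (s + s' - pm) * (pp : ℤ) = 0 := by linear_combination pm * hr - h
    have := (mul_eq_zero.mp hs).resolve_right hpp0.ne'
    omega
  · rintro ⟨rfl, rfl⟩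
    ring
end

section
/- For every β ∈ ℂ, ( ∏_{i=1}^{p₊−1} ∏_{j=1}^{p₋−1} (β − β_{i,j}) )² = 2^{(p₊−1)(p₋−1)} · ∏_{i=1}^{p₊−1} ∏_{j=1}^{p₋−1} (h_β − h_{i,j}). (This is the factorization g₀(h_β) = ω₀(β), up to a nonzero constant, of the zero-mode eigenvalue ω₀(β) of W_{0,0}[0] as a product of the factors h_β − Δ_{i,j} over the Kac table.) -/
theorem mul_alphaP_add_mul_alphaM (pp pm : ℕ) (hpp : 0 < pp) (hpm : 0 < pm) :
    (pp : ℂ) * alphaP pp pm + (pm : ℂ) * alphaM pp pm = 0 := by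
  have mul_sqrt_div (a b : ℕ) (ha : 0 < a) :
      (a : ℝ) * Real.sqrt (2 * (b : ℝ) / (a : ℝ)) = Real.sqrt (2 * a * b) := by
    have ha' : (0 : ℝ) < a := by exact_mod_cast ha
    have h : (2 * a * b : ℝ) = (a : ℝ) ^ 2 * (2 * b / a) := by field_simp
    rw [h, Real.sqrt_mul (by positivity), Real.sqrt_sq ha'.le]
  have h : (pp : ℝ) * Real.sqrt (2 * (pm : ℝ) / (pp : ℝ))
      = (pm : ℝ) * Real.sqrt (2 * (pp : ℝ) / (pm : ℝ)) := by
    rw [mul_sqrt_div pp pm hpp, mul_sqrt_div pm pp hpm, mul_right_comm]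
  have hc := congrArg (Complex.ofReal) h
  push_cast at hc
  unfold alphaP alphaM
  linear_combination hc

/-- The Kac symmetry `β_{p₊−r,p₋−s} = α₀ − β_{r,s}`. -/
theorem betaRS_reflect (pp pm : ℕ) (hpp : 0 < pp) (hpm : 0 < pm) (r s : ℤ) :
    betaRS pp pm (pp - r) (pm - s) = alpha0 pp pm - betaRS pp pm r s := by
  have h := mul_alphaP_add_mul_alphaM pp pm hpp hpm
  unfold betaRS alpha0
  push_cast
  linear_combination (-1 / 2 : ℂ) * h

theorem two_mul_hwt_sub_hRS (pp pm : ℕ) (hpp : 0 < pp) (hpm : 0 < pm) (β : ℂ) (r s : ℤ) :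
    2 * (hwt pp pm β - hRS pp pm r s)
      = (β - betaRS pp pm r s) * (β - betaRS pp pm (pp - r) (pm - s)) := by
  rw [betaRS_reflect pp pm hpp hpm]
  unfold hRS hwt
  ring

theorem prod_Icc_one_pred_reflect {M : Type*} [CommMonoid M] (n : ℕ) (f : ℤ → M) :
    ∏ i ∈ Finset.Icc 1 (n - 1), f ((n : ℤ) - (i : ℤ)) = ∏ i ∈ Finset.Icc 1 (n - 1), f (i : ℤ) := by
  refine Finset.prod_nbij' (fun i => n - i) (fun i => n - i) ?_ ?_ ?_ ?_ ?_ <;>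
    intro i hi <;> rw [Finset.mem_Icc] at hi
  · rw [Finset.mem_Icc]; omega
  · rw [Finset.mem_Icc]; omega
  · omega
  · omega
  · rw [Nat.cast_sub (by omega)]

/-- the factorization `ω₀(β)² = 2^{(p₊−1)(p₋−1)} · g₀(h_β)` of the
zero-mode eigenvalue of `W_{0,0}[0]`. -/
theorem omega0_sq_factorization (pp pm : ℕ) (hpp : 2 ≤ pp) (hpm : 2 ≤ pm)
    (hco : Nat.Coprime pp pm) (β : ℂ) :
    (∏ i ∈ Finset.Icc 1 (pp - 1), ∏ j ∈ Finset.Icc 1 (pm - 1),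
        (β - betaRS pp pm (i : ℤ) (j : ℤ))) ^ 2
      = 2 ^ ((pp - 1) * (pm - 1)) *
        ∏ i ∈ Finset.Icc 1 (pp - 1), ∏ j ∈ Finset.Icc 1 (pm - 1),
          (hwt pp pm β - hRS pp pm (i : ℤ) (j : ℤ)) := by
  have hpow : (2 : ℂ) ^ ((pp - 1) * (pm - 1))
      = ∏ _i ∈ Finset.Icc 1 (pp - 1), ∏ _j ∈ Finset.Icc 1 (pm - 1), (2 : ℂ) := by
    simp [← pow_mul, mul_comm]
  have hrefl : ∏ i ∈ Finset.Icc 1 (pp - 1), ∏ j ∈ Finset.Icc 1 (pm - 1),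
        (β - betaRS pp pm ((pp : ℤ) - (i : ℤ)) ((pm : ℤ) - (j : ℤ)))
      = ∏ i ∈ Finset.Icc 1 (pp - 1), ∏ j ∈ Finset.Icc 1 (pm - 1),
        (β - betaRS pp pm (i : ℤ) (j : ℤ)) := by
    rw [← prod_Icc_one_pred_reflect pp
      fun r => ∏ j ∈ Finset.Icc 1 (pm - 1), (β - betaRS pp pm r (j : ℤ))]
    exact Finset.prod_congr rfl fun i _ =>
      prod_Icc_one_pred_reflect pm fun s => β - betaRS pp pm ((pp : ℤ) - (i : ℤ)) s
  rw [hpow, sq]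
  nth_rewrite 2 [← hrefl]
  simp only [← Finset.prod_mul_distrib, two_mul_hwt_sub_hRS pp pm (by omega) (by omega)]
end

section
/- For every β ∈ ℂ, ( ∏_{i=1}^{3p₊−1} ∏_{j=1}^{3p₋−1} (β − β_{i,j}) )² = 2^{(3p₊−1)(3p₋−1)} · [ ∏_{i=1}^{p₊−1} ∏_{j=1}^{p₋−1} (h_β − h_{i,j})³ · (h_β − h_{2p₊−i,j})⁴ · (h_β − h_{3p₊−i,j})² ] · [ ∏_{i=1}^{p₊−1} (h_β − h_{2p₊−i,p₋})⁴ · (h_β − h_{3p₊−i,p₋})² ] · [ ∏_{j=1}^{p₋−1} (h_β − h_{p₊,2p₋−j})⁴ · (h_β − h_{p₊,3p₋−j})² ] · (h_β − h_{p₊,p₋})² · (h_β − h_{2p₊,p₋})². (This is the square of the factorization g₂(h_β) = ω₂(β) of the zero-mode eigenvalue ω₂(β) of W_{2,0}[0]: the Kac-table weights Δ_{i,j} occur with exponent 3 per class, the weights Δ⁺_{r,s;0} with exponent 2, and the weights Δ⁻_{r,s;0} with exponent 1, for 1 ≤ r ≤ p₊, 1 ≤ s ≤ p₋.) -/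
section BlockProducts

variable {M : Type*} [CommMonoid M]

theorem prod_Icc_reflect (f : ℤ → M) (n : ℕ) :
    ∏ i ∈ Finset.Icc 1 (n - 1), f ((n : ℤ) - (i : ℤ)) = ∏ i ∈ Finset.Icc 1 (n - 1), f (i : ℤ) := by
  refine Finset.prod_nbij' (fun i => n - i) (fun i => n - i) ?_ ?_ ?_ ?_ ?_
  iterate 4
    intro i hi
    simp only [Finset.mem_Icc] at *
    omega
  intro i hi
  simp only [Finset.mem_Icc] at hi
  congr 1
  omega

theorem prod_Icc_three_blocks (f : ℤ → M) (n : ℕ) (hn : 1 ≤ n) :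
    ∏ i ∈ Finset.Icc 1 (3 * n - 1), f (i : ℤ) =
      (∏ i ∈ Finset.Icc 1 (n - 1), f (i : ℤ)) * f n *
        (∏ i ∈ Finset.Icc 1 (n - 1), f (n + (i : ℤ))) * f (2 * n) *
        (∏ i ∈ Finset.Icc 1 (n - 1), f (2 * n + (i : ℤ))) := by
  obtain ⟨m, rfl⟩ : ∃ m, n = m + 1 := ⟨n - 1, by omega⟩
  have key (k : ℕ) (g : ℤ → M) :
      ∏ i ∈ Finset.Icc 1 k, g (i : ℤ) = ∏ i ∈ Finset.range k, g ((i : ℤ) + 1) := by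
    induction k with
    | zero => simp
    | succ k ih => rw [Finset.prod_Icc_succ_top (by omega), ih, Finset.prod_range_succ]; simp
  rw [show 3 * (m + 1) - 1 = m + 1 + m + 1 + m by omega, Nat.add_sub_cancel, key, key,
    key m fun i => f (((m + 1 : ℕ) : ℤ) + i), key m fun i => f (2 * ((m + 1 : ℕ) : ℤ) + i),
    Finset.prod_range_add, Finset.prod_range_succ _ (m + 1 + m), Finset.prod_range_add,
    Finset.prod_range_succ _ m]
  push_cast
  congr 1
  · congr 2
    ring
  · exact Finset.prod_congr rfl fun i _ => congrArg f (by ring)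

variable (H : ℤ → M) (p q : ℕ)

/-- The product of `H` over the interior points of the `p × q` grid, shifted by `k * p * q`. -/
def gridProd (k : ℤ) : M :=
  ∏ i ∈ Finset.Icc 1 (p - 1), ∏ j ∈ Finset.Icc 1 (q - 1), H ((i : ℤ) * q - j * p + k * (p * q))

/-- The product of `H` over the interior points of an edge with `q` steps of length `p`,
reflected and shifted by `k * p * q`. -/
def edgeProd (k : ℤ) : M :=
  ∏ j ∈ Finset.Icc 1 (q - 1), H (k * (p * q) - (j : ℤ) * p)

variable {H}

theorem gridProd_neg (hH : ∀ n, H (-n) = H n) (k : ℤ) : gridProd H p q (-k) = gridProd H p q k := by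
  unfold gridProd
  rw [← prod_Icc_reflect (fun i => ∏ j ∈ Finset.Icc 1 (q - 1), H (i * q - j * p + k * (p * q)))]
  refine Finset.prod_congr rfl fun i _ => ?_
  rw [← prod_Icc_reflect (fun j => H (((p : ℤ) - i) * q - j * p + k * (p * q)))]
  refine Finset.prod_congr rfl fun j _ => ?_
  rw [← hH]
  exact congrArg H (by ring)

theorem edgeProd_one_sub (hH : ∀ n, H (-n) = H n) (k : ℤ) :
    edgeProd H p q (1 - k) = edgeProd H p q k := by
  unfold edgeProd
  rw [← prod_Icc_reflect (fun j => H (k * (p * q) - j * p))]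
  refine Finset.prod_congr rfl fun j _ => ?_
  rw [← hH]
  exact congrArg H (by ring)

theorem prod_grid_three_blocks (hH : ∀ n, H (-n) = H n) (hp : 1 ≤ p) (hq : 1 ≤ q) :
    ∏ i ∈ Finset.Icc 1 (3 * p - 1), ∏ j ∈ Finset.Icc 1 (3 * q - 1), H ((i : ℤ) * q - j * p) =
      gridProd H p q 0 ^ 3 * gridProd H p q 1 ^ 4 * gridProd H p q 2 ^ 2 *
        (edgeProd H q p 1 ^ 4 * edgeProd H q p 2 ^ 2) *
        (edgeProd H p q 1 ^ 4 * edgeProd H p q 2 ^ 2) * H 0 ^ 2 * H (p * q) ^ 2 := by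
  have inner (x : ℤ) : ∏ j ∈ Finset.Icc 1 (3 * q - 1), H (x - (j : ℤ) * p) =
      (∏ j ∈ Finset.Icc 1 (q - 1), H (x - (j : ℤ) * p)) * H (x - p * q) *
        (∏ j ∈ Finset.Icc 1 (q - 1), H (x - (j : ℤ) * p - p * q)) * H (x - 2 * (p * q)) *
        (∏ j ∈ Finset.Icc 1 (q - 1), H (x - (j : ℤ) * p - 2 * (p * q))) := by
    rw [prod_Icc_three_blocks (fun j => H (x - j * p)) q hq]
    ring_nf
  have grid (a b k : ℤ) (h : a - b = k) :
      ∏ i ∈ Finset.Icc 1 (p - 1), ∏ j ∈ Finset.Icc 1 (q - 1),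
        H ((a * p + (i : ℤ)) * q - j * p - b * (p * q)) = gridProd H p q k := by
    subst h
    refine Finset.prod_congr rfl fun i _ => Finset.prod_congr rfl fun j _ => congrArg H (by ring)
  have col (a b k : ℤ) (h : b - a = k) : ∏ i ∈ Finset.Icc 1 (p - 1),
      H ((a * p + (i : ℤ)) * q - b * (p * q)) = edgeProd H q p k := by
    subst h
    refine Finset.prod_congr rfl fun i _ => ?_
    rw [← hH]
    exact congrArg H (by ring)
  have row (a b k : ℤ) (h : a - b = k) : ∏ j ∈ Finset.Icc 1 (q - 1),
      H (a * p * q - (j : ℤ) * p - b * (p * q)) = edgeProd H p q k := by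
    subst h
    exact Finset.prod_congr rfl fun j _ => congrArg H (by ring)
  have block (a : ℤ) : ∏ i ∈ Finset.Icc 1 (p - 1), ∏ j ∈ Finset.Icc 1 (3 * q - 1),
      H ((a * p + (i : ℤ)) * q - j * p) =
        gridProd H p q a * edgeProd H q p (1 - a) * gridProd H p q (a - 1) *
          edgeProd H q p (2 - a) * gridProd H p q (a - 2) := by
    rw [← grid a 0 a (by ring), ← grid a 1 _ rfl, ← grid a 2 _ rfl, ← col a 1 _ rfl,
      ← col a 2 _ rfl]
    simp only [inner, Finset.prod_mul_distrib, zero_mul, one_mul, sub_zero]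
  have line (a : ℤ) : ∏ j ∈ Finset.Icc 1 (3 * q - 1), H (a * p * q - (j : ℤ) * p) =
      edgeProd H p q a * H ((a - 1) * (p * q)) * edgeProd H p q (a - 1) *
        H ((a - 2) * (p * q)) * edgeProd H p q (a - 2) := by
    rw [← row a 0 a (by ring), ← row a 1 _ rfl, ← row a 2 _ rfl, inner]
    simp only [zero_mul, one_mul, sub_zero, sub_mul, mul_assoc]
  have b0 := block 0
  have b1 := block 1
  have b2 := block 2
  have l1 := line 1
  have l2 := line 2
  have g1 := gridProd_neg p q hH 1
  have g2 := gridProd_neg p q hH 2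
  have e0 (p q : ℕ) : edgeProd H p q 0 = edgeProd H p q 1 := edgeProd_one_sub p q hH 1
  have e1 (p q : ℕ) : edgeProd H p q (-1) = edgeProd H p q 2 := edgeProd_one_sub p q hH 2
  have h1 := hH (p * q)
  norm_num at b0 b1 b2 l1 l2
  rw [prod_Icc_three_blocks
    (fun i => ∏ j ∈ Finset.Icc 1 (3 * q - 1), H (i * q - (j : ℤ) * p)) p hp,
    b0, b1, b2, l1, l2, g1, g2, h1]
  simp only [e0, e1, pow_succ, pow_zero, one_mul]
  ac_rfl

end BlockProducts

theorem natCast_mul_alphaP_add_natCast_mul_alphaM (pp pm : ℕ) (hpp : pp ≠ 0) (hpm : pm ≠ 0) :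
    (pp : ℂ) * alphaP pp pm + pm * alphaM pp pm = 0 := by
  have key (a b : ℕ) (ha : a ≠ 0) :
      (a : ℝ) * Real.sqrt (2 * b / a) = Real.sqrt (2 * a * b) := by
    have ha' : (a : ℝ) ≠ 0 := by exact_mod_cast ha
    rw [show (2 * a * b : ℝ) = a ^ 2 * (2 * b / a) by field_simp,
      Real.sqrt_mul (sq_nonneg _), Real.sqrt_sq (Nat.cast_nonneg a)]
  have h : (pp : ℝ) * Real.sqrt (2 * pm / pp) = pm * Real.sqrt (2 * pp / pm) := by
    rw [key pp pm hpp, key pm pp hpm]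
    congr 1
    ring
  have h' := congrArg (fun x : ℝ => (x : ℂ)) h
  push_cast at h'
  unfold alphaP alphaM
  linear_combination h'

/-- `h_β - h_{r,s}` as a function of `n = r p₋ - s p₊`. -/
noncomputable def weightDiff (pp pm : ℕ) (β : ℂ) (n : ℤ) : ℂ :=
  ((β - alpha0 pp pm / 2) ^ 2 - (alphaP pp pm / pm * n / 2) ^ 2) / 2

theorem weightDiff_neg (pp pm : ℕ) (β : ℂ) (n : ℤ) :
    weightDiff pp pm β (-n) = weightDiff pp pm β n := by
  unfold weightDiff
  push_cast
  ring

theorem betaRS_eq (pp pm : ℕ) (hpp : pp ≠ 0) (hpm : pm ≠ 0) (r s : ℤ) :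
    betaRS pp pm r s =
      alpha0 pp pm / 2 - alphaP pp pm / pm * ((r * pm - s * pp : ℤ) : ℂ) / 2 := by
  have hpm' : (pm : ℂ) ≠ 0 := by exact_mod_cast hpm
  have h := natCast_mul_alphaP_add_natCast_mul_alphaM pp pm hpp hpm
  unfold betaRS alpha0
  push_cast
  field_simp
  linear_combination -(s : ℂ) * h

theorem hwt_sub_hRS (pp pm : ℕ) (hpp : pp ≠ 0) (hpm : pm ≠ 0) (β : ℂ) (r s : ℤ) :
    hwt pp pm β - hRS pp pm r s = weightDiff pp pm β (r * pm - s * pp) := by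
  unfold hRS hwt weightDiff
  rw [betaRS_eq pp pm hpp hpm]
  ring

theorem sub_betaRS_mul_reflect (pp pm : ℕ) (hpp : pp ≠ 0) (hpm : pm ≠ 0) (β : ℂ) (r s : ℤ) :
    (β - betaRS pp pm r s) * (β - betaRS pp pm (((3 * pp : ℕ) : ℤ) - r) (((3 * pm : ℕ) : ℤ) - s)) =
      2 * weightDiff pp pm β (r * pm - s * pp) := by
  unfold weightDiff
  rw [betaRS_eq pp pm hpp hpm, betaRS_eq pp pm hpp hpm]
  push_cast
  ring

theorem prod_sub_betaRS_sq (pp pm : ℕ) (hpp : pp ≠ 0) (hpm : pm ≠ 0) (β : ℂ) :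
    (∏ i ∈ Finset.Icc 1 (3 * pp - 1), ∏ j ∈ Finset.Icc 1 (3 * pm - 1),
        (β - betaRS pp pm (i : ℤ) (j : ℤ))) ^ 2
      = 2 ^ ((3 * pp - 1) * (3 * pm - 1)) *
        ∏ i ∈ Finset.Icc 1 (3 * pp - 1), ∏ j ∈ Finset.Icc 1 (3 * pm - 1),
          weightDiff pp pm β ((i : ℤ) * pm - j * pp) := by
  rw [sq]
  conv_lhs =>
    rhs
    rw [← prod_Icc_reflect
      (fun i => ∏ j ∈ Finset.Icc 1 (3 * pm - 1), (β - betaRS pp pm i (j : ℤ)))]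
    enter [2, i]
    rw [← prod_Icc_reflect (fun j => β - betaRS pp pm (((3 * pp : ℕ) : ℤ) - i) j)]
  simp_rw [← Finset.prod_mul_distrib, sub_betaRS_mul_reflect pp pm hpp hpm,
    Finset.prod_mul_distrib, Finset.prod_const, Nat.card_Icc, Nat.add_sub_cancel]
  rw [← pow_mul, mul_comm (3 * pm - 1)]

/-- the factorization of `ω₂(β)² = 2^{(3p₊−1)(3p₋−1)} · g₂(h_β)²`,
the square of the zero-mode eigenvalue of `W_{2,0}[0]`. -/
theorem omega2_sq_factorization (pp pm : ℕ) (hpp : 2 ≤ pp) (hpm : 2 ≤ pm)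
    (hco : Nat.Coprime pp pm) (β : ℂ) :
    (∏ i ∈ Finset.Icc 1 (3 * pp - 1), ∏ j ∈ Finset.Icc 1 (3 * pm - 1),
        (β - betaRS pp pm (i : ℤ) (j : ℤ))) ^ 2
      = 2 ^ ((3 * pp - 1) * (3 * pm - 1)) *
        (∏ i ∈ Finset.Icc 1 (pp - 1), ∏ j ∈ Finset.Icc 1 (pm - 1),
            ((hwt pp pm β - hRS pp pm (i : ℤ) (j : ℤ)) ^ 3 *
              (hwt pp pm β - hRS pp pm (2 * (pp : ℤ) - (i : ℤ)) (j : ℤ)) ^ 4 *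
              (hwt pp pm β - hRS pp pm (3 * (pp : ℤ) - (i : ℤ)) (j : ℤ)) ^ 2)) *
        (∏ i ∈ Finset.Icc 1 (pp - 1),
            ((hwt pp pm β - hRS pp pm (2 * (pp : ℤ) - (i : ℤ)) (pm : ℤ)) ^ 4 *
              (hwt pp pm β - hRS pp pm (3 * (pp : ℤ) - (i : ℤ)) (pm : ℤ)) ^ 2)) *
        (∏ j ∈ Finset.Icc 1 (pm - 1),
            ((hwt pp pm β - hRS pp pm (pp : ℤ) (2 * (pm : ℤ) - (j : ℤ))) ^ 4 *
              (hwt pp pm β - hRS pp pm (pp : ℤ) (3 * (pm : ℤ) - (j : ℤ))) ^ 2)) *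
        (hwt pp pm β - hRS pp pm (pp : ℤ) (pm : ℤ)) ^ 2 *
        (hwt pp pm β - hRS pp pm (2 * (pp : ℤ)) (pm : ℤ)) ^ 2 := by
  have hp : pp ≠ 0 := by omega
  have hq : pm ≠ 0 := by omega
  have hH := weightDiff_neg pp pm β
  rw [prod_sub_betaRS_sq pp pm hp hq,
    prod_grid_three_blocks pp pm hH (by omega) (by omega)]
  simp_rw [hwt_sub_hRS pp pm hp hq, Finset.prod_mul_distrib, Finset.prod_pow]
  have grid (k : ℤ) : ∏ i ∈ Finset.Icc 1 (pp - 1), ∏ j ∈ Finset.Icc 1 (pm - 1),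
      weightDiff pp pm β (((k + 1) * pp - i) * pm - j * pp) =
        gridProd (weightDiff pp pm β) pp pm k := by
    unfold gridProd
    rw [← prod_Icc_reflect (fun i => ∏ j ∈ Finset.Icc 1 (pm - 1),
      weightDiff pp pm β (i * pm - j * pp + k * (pp * pm)))]
    exact Finset.prod_congr rfl fun i _ => Finset.prod_congr rfl fun j _ =>
      congrArg (weightDiff pp pm β) (by ring)
  have g0 : ∏ i ∈ Finset.Icc 1 (pp - 1), ∏ j ∈ Finset.Icc 1 (pm - 1),
      weightDiff pp pm β ((i : ℤ) * pm - j * pp) =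
        gridProd (weightDiff pp pm β) pp pm 0 := by
    simp [gridProd]
  have col (k : ℤ) : ∏ i ∈ Finset.Icc 1 (pp - 1),
      weightDiff pp pm β (((k + 1) * pp - i) * pm - pm * pp) =
        edgeProd (weightDiff pp pm β) pm pp k :=
    Finset.prod_congr rfl fun i _ => congrArg (weightDiff pp pm β) (by ring)
  have row (k : ℤ) : ∏ j ∈ Finset.Icc 1 (pm - 1),
      weightDiff pp pm β (pp * pm - ((k + 1) * pm - j) * pp) =
        edgeProd (weightDiff pp pm β) pp pm k := by
    refine Finset.prod_congr rfl fun j _ => ?_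
    rw [← hH]
    exact congrArg (weightDiff pp pm β) (by ring)
  have g1 := grid 1
  have g2 := grid 2
  have c1 := col 1
  have c2 := col 2
  have r1 := row 1
  have r2 := row 2
  norm_num only at g1 g2 c1 c2 r1 r2
  rw [g0, g1, g2, c1, c2, r1, r2, show (pp * pm - pm * pp : ℤ) = 0 by ring,
    show (2 * pp * pm - pm * pp : ℤ) = pp * pm by ring]
  ring
end

section
/- The operators L_n satisfy the commutation relations of the Virasoro algebra with central charge c = 1 − 3α₀²: for all m, n ∈ ℤ and all P ∈ F, (L_m ∘ L_n − L_n ∘ L_m)(P) = (m − n)·L_{m+n}(P) + ((1 − 3α₀²)/12)·(m³ − m)·δ_{m+n,0}·P. -/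
open MvPolynomial

/-- The Fock module `F_β = ℂ[x₁, x₂, …]`, the polynomial ring over `ℂ` in
countably many variables indexed by `ℕ+`. -/
abbrev Fock : Type := MvPolynomial ℕ+ ℂ

/-- The Heisenberg operators `b_n : F → F`: for `n ≥ 1`, `b_n = n·∂/∂x_n` and
`b_{−n}` is multiplication by `x_n`, while `b₀ = β·id`. -/
noncomputable def bop (β : ℂ) (n : ℤ) : Fock →ₗ[ℂ] Fock :=
  if h : 0 < n then
    (n : ℂ) • (pderiv (⟨n.toNat, by omega⟩ : ℕ+)).toLinearMap
  else if h' : n < 0 then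
    LinearMap.mulLeft ℂ (X (⟨(-n).toNat, by omega⟩ : ℕ+))
  else
    β • (LinearMap.id : Fock →ₗ[ℂ] Fock)

/-- The normally ordered product `:b_{n−k} b_k:`, i.e. `b_j ∘ b_i` for
`(i,j) = (n−k,k)` if `i > j` and `b_i ∘ b_j` otherwise. -/
noncomputable def nord (β : ℂ) (n k : ℤ) : Fock →ₗ[ℂ] Fock :=
  if n - k > k then bop β k ∘ₗ bop β (n - k) else bop β (n - k) ∘ₗ bop β k

/-- The Virasoro operator
`L_n = (1/2)·Σ_{k∈ℤ} :b_{n−k} b_k: − (α₀/2)(n+1)·b_n` on the Fock module; on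
each fixed polynomial only finitely many summands are nonzero, so the
(finitely supported) sum `∑ᶠ` gives the honest value. -/
noncomputable def virL (α₀ β : ℂ) (n : ℤ) (P : Fock) : Fock :=
  (1 / 2 : ℂ) • (∑ᶠ k : ℤ, nord β n k P) - ((α₀ / 2) * ((n : ℂ) + 1)) • bop β n P

theorem bop_coe (β : ℂ) (i : ℕ+) (P : Fock) : bop β (i : ℕ) P = (i : ℂ) • pderiv i P := by
  rw [bop, dif_pos (by exact_mod_cast i.pos)]
  rfl

theorem bop_neg_coe (β : ℂ) (i : ℕ+) (P : Fock) : bop β (-(i : ℕ)) P = X i * P := by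
  have h : 0 < (i : ℕ) := i.pos
  rw [bop, dif_neg (by omega), dif_pos (by omega), LinearMap.mulLeft_apply]
  congr 2
  exact PNat.eq (by simp)

theorem bop_zero (β : ℂ) (P : Fock) : bop β 0 P = β • P := by
  simp [bop]

theorem pderiv_comm {σ R : Type*} [CommSemiring R] (i j : σ) (P : MvPolynomial σ R) :
    pderiv i (pderiv j P) = pderiv j (pderiv i P) := by
  classical
  induction P using MvPolynomial.induction_on with
  | C a => simp
  | add p q hp hq => simp [hp, hq]
  | mul_X p k hp =>
    have hX : ∀ i j : σ, pderiv i (pderiv j (X k : MvPolynomial σ R)) = 0 := fun i j ↦ by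
      rw [pderiv_X, Pi.single_apply]
      split_ifs <;> simp
    simp only [pderiv_mul, map_add, hp, hX, mul_zero, add_zero]
    exact add_right_comm _ _ _

theorem exists_pnat_eq (n : ℤ) : n = 0 ∨ ∃ i : ℕ+, n = (i : ℕ) ∨ n = -(i : ℕ) := by
  by_cases h : n = 0
  · exact .inl h
  · refine .inr ⟨⟨n.natAbs, Int.natAbs_pos.mpr h⟩, ?_⟩
    simp only [PNat.mk_coe]
    omega

/-- The operators `b_n` satisfy the Heisenberg commutation relations. -/
theorem bop_comm (β : ℂ) (m n : ℤ) (P : Fock) :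
    bop β m (bop β n P) = bop β n (bop β m P) + (if m + n = 0 then (m : ℂ) else 0) • P := by
  obtain rfl | ⟨i, hi⟩ := exists_pnat_eq m
  · simp [bop_zero]
  obtain rfl | ⟨j, hj⟩ := exists_pnat_eq n
  · simp only [bop_zero, map_smul, add_zero]
    split_ifs with h <;> simp [h]
  have hipos : 0 < (i : ℕ) := i.pos
  have hjpos : 0 < (j : ℕ) := j.pos
  rcases hi with rfl | rfl <;> rcases hj with rfl | rfl
  · rw [if_neg (by omega)]
    simp only [bop_coe, Derivation.map_smul, pderiv_comm i j]
    module
  · simp only [bop_coe, bop_neg_coe, Derivation.leibniz, pderiv_X, Pi.single_apply]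
    by_cases h : i = j
    · subst h
      simp [smul_eq_C_mul]
      ring
    · rw [if_neg (Ne.symm h), if_neg fun h' ↦ h (PNat.eq (by omega))]
      simp
  · simp only [bop_coe, bop_neg_coe, Derivation.leibniz, pderiv_X, Pi.single_apply]
    by_cases h : i = j
    · subst h
      simp [smul_eq_C_mul, mul_left_comm]
    · rw [if_neg h, if_neg fun h' ↦ h (PNat.eq (by omega))]
      simp
  · rw [if_neg (by omega)]
    simp [bop_neg_coe, mul_left_comm]

theorem exists_bop_eq_zero (β : ℂ) (P : Fock) : ∃ N : ℤ, ∀ k, N < k → bop β k P = 0 := by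
  refine ⟨((P.vars.sup fun i ↦ (i : ℕ) : ℕ) : ℤ), fun k hk ↦ ?_⟩
  obtain ⟨i, rfl⟩ : ∃ i : ℕ+, k = (i : ℕ) := by
    obtain rfl | ⟨i, rfl | rfl⟩ := exists_pnat_eq k
    · omega
    · exact ⟨i, rfl⟩
    · omega
  have hi : i ∉ P.vars := fun hmem ↦ by
    have := Finset.le_sup (f := fun i : ℕ+ ↦ (i : ℕ)) hmem
    omega
  rw [bop_coe, pderiv_eq_zero_of_notMem_vars hi, smul_zero]

theorem finite_support_nord (β : ℂ) (n : ℤ) (P : Fock) :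
    (Function.support fun k ↦ nord β n k P).Finite := by
  obtain ⟨N, hN⟩ := exists_bop_eq_zero β P
  refine (Set.finite_Icc (n - N) N).subset fun k hk ↦ ?_
  by_contra hmem
  rw [Set.mem_Icc, not_and_or] at hmem
  apply hk
  by_cases h : n - k > k
  · simp [nord, h, hN (n - k) (by omega)]
  · simp [nord, h, hN k (by omega)]

theorem bop_bop_eq_nord (β : ℂ) (n k : ℤ) (P : Fock) :
    bop β (n - k) (bop β k P) =
      nord β n k P + (if n = 0 ∧ k < n - k then ((n - k : ℤ) : ℂ) else 0) • P := by
  unfold nord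
  by_cases h : k < n - k
  · simp [h, bop_comm β (n - k) k]
  · simp [h]

/-- The quadratic part `Σ_k :b_{n-k} b_k:` of `2 L_n`, as a linear operator. -/
noncomputable def nordSum (β : ℂ) (n : ℤ) : Fock →ₗ[ℂ] Fock where
  toFun P := ∑ᶠ k : ℤ, nord β n k P
  map_add' P Q := by
    simp only [map_add]
    exact finsum_add_distrib (finite_support_nord β n P) (finite_support_nord β n Q)
  map_smul' c P := by
    simp only [map_smul, RingHom.id_apply]
    exact (smul_finsum c _).symm

theorem nordSum_apply (β : ℂ) (n : ℤ) (P : Fock) :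
    nordSum β n P = ∑ᶠ k : ℤ, nord β n k P := rfl

theorem virL_eq (α₀ β : ℂ) (n : ℤ) (P : Fock) :
    virL α₀ β n P = (1 / 2 : ℂ) • nordSum β n P - ((α₀ / 2) * ((n : ℂ) + 1)) • bop β n P := rfl

theorem nord_bop (β : ℂ) (n k m : ℤ) (P : Fock) :
    nord β n k (bop β m P) - bop β m (nord β n k P) =
      (if k = -m then -(m : ℂ) • bop β (n + m) P else 0) +
        (if k = n + m then -(m : ℂ) • bop β (n + m) P else 0) := by
  have h1 := bop_bop_eq_nord β n k (bop β m P)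
  have h2 := congrArg (bop β m) (bop_bop_eq_nord β n k P)
  rw [map_add, map_smul] at h2
  have h3 : bop β (n - k) (bop β k (bop β m P)) - bop β m (bop β (n - k) (bop β k P)) =
      (if k + m = 0 then (k : ℂ) else 0) • bop β (n - k) P +
        (if n - k + m = 0 then ((n - k : ℤ) : ℂ) else 0) • bop β k P := by
    rw [bop_comm β k m, map_add, map_smul, bop_comm β (n - k) m]
    abel
  have h4 : nord β n k (bop β m P) - bop β m (nord β n k P) =
      (if k + m = 0 then (k : ℂ) else 0) • bop β (n - k) P +
        (if n - k + m = 0 then ((n - k : ℤ) : ℂ) else 0) • bop β k P := by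
    rw [← h3, h1, h2]; abel
  rw [h4]
  congr 1
  · by_cases h : k = -m
    · subst h; simp
    · rw [if_neg (by omega), if_neg h, zero_smul]
  · by_cases h : k = n + m
    · subst h; simp
    · rw [if_neg (by omega), if_neg h, zero_smul]

theorem finsum_ite_eq_const {M : Type*} [AddCommMonoid M] (a : ℤ) (x : M) :
    ∑ᶠ k : ℤ, (if k = a then x else 0) = x := by
  rw [finsum_eq_single _ a fun k hk ↦ if_neg hk, if_pos rfl]

theorem finite_support_ite_eq_const {M : Type*} [AddCommMonoid M] (a : ℤ) (x : M) :
    (Function.support fun k : ℤ ↦ if k = a then x else 0).Finite :=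
  (Set.finite_singleton a).subset fun k hk ↦ by
    by_contra h
    exact hk (if_neg h)

theorem nordSum_bop (β : ℂ) (n m : ℤ) (P : Fock) :
    nordSum β n (bop β m P) = bop β m (nordSum β n P) - (2 * m : ℂ) • bop β (n + m) P := by
  have hs := finite_support_nord β n P
  have hs' : (Function.support fun k ↦ bop β m (nord β n k P)).Finite :=
    hs.subset fun k hk h ↦ hk (by simp only [h, map_zero])
  have key : nordSum β n (bop β m P) - bop β m (nordSum β n P) =
      ∑ᶠ k : ℤ, (nord β n k (bop β m P) - bop β m (nord β n k P)) := by
    rw [nordSum_apply, nordSum_apply, map_finsum _ hs,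
      finsum_sub_distrib (finite_support_nord β n _) hs']
  simp only [nord_bop] at key
  rw [finsum_add_distrib (finite_support_ite_eq_const _ _) (finite_support_ite_eq_const _ _),
    finsum_ite_eq_const, finsum_ite_eq_const, sub_eq_iff_eq_add] at key
  rw [key]
  module

/-- The scalar produced by normally ordering the `k`-th term of the commutator of the quadratic
parts of `L_{-n}` and `L_n`. -/
noncomputable def anomaly (n k : ℤ) : ℂ :=
  (k * (n - k) : ℂ) * ((if k < n then 1 else 0) - (if k < 0 then 1 else 0))

theorem nordSum_nord (β : ℂ) (m n k : ℤ) (P : Fock) :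
    nordSum β m (nord β n k P) - nord β n k (nordSum β m P) =
      (-2 * (n - k) : ℂ) • nord β (m + n) k P + (-2 * k : ℂ) • nord β (m + n) (k + m) P
        + (if m + n = 0 then -2 * anomaly n k else 0) • P := by
  have h1 := bop_bop_eq_nord β n k (nordSum β m P)
  have h2 := congrArg (nordSum β m) (bop_bop_eq_nord β n k P)
  rw [map_add, map_smul] at h2
  have h3 : nordSum β m (bop β (n - k) (bop β k P)) - bop β (n - k) (bop β k (nordSum β m P)) =
      (-2 * (n - k) : ℂ) • bop β (m + n - k) (bop β k P) +
        (-2 * k : ℂ) • bop β (m + n - (k + m)) (bop β (k + m) P) := by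
    rw [nordSum_bop, nordSum_bop, map_sub, map_smul, show m + n - (k + m) = n - k by ring,
      show m + n - k = m + (n - k) by ring, add_comm k m]
    push_cast
    module
  rw [bop_bop_eq_nord β (m + n), bop_bop_eq_nord β (m + n)] at h3
  have h4 : nordSum β m (nord β n k P) - nord β n k (nordSum β m P) =
      nordSum β m (bop β (n - k) (bop β k P)) -
        bop β (n - k) (bop β k (nordSum β m P)) := by
    rw [h1, h2]; abel
  rw [h4, h3]
  by_cases h : m + n = 0
  · obtain rfl : m = -n := by omega
    have e1 : (k < 0 - k) ↔ k < 0 := by omega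
    have e2 : (k + -n < 0 - (k + -n)) ↔ k < n := by omega
    simp only [e1, e2, neg_add_cancel, true_and, if_true, anomaly]
    split_ifs <;> push_cast <;> module
  · simp [h]

theorem sum_Ico_zero (c : ℂ) (N : ℕ) :
    ∑ k ∈ Finset.Ico (0 : ℤ) N, ((k : ℂ) * (c - k)) =
      c * (N * (N - 1) / 2) - (N - 1) * N * (2 * N - 1) / 6 := by
  induction N with
  | zero => simp
  | succ N ih =>
    have : Finset.Ico (0 : ℤ) ((N + 1 : ℕ) : ℤ) = insert (N : ℤ) (Finset.Ico (0 : ℤ) N) := by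
      ext; simp only [Finset.mem_Ico, Finset.mem_insert]; omega
    rw [this, Finset.sum_insert (by simp), ih]
    push_cast
    ring

theorem sum_Ico_neg_zero (c : ℂ) (N : ℕ) :
    ∑ k ∈ Finset.Ico (-N : ℤ) 0, ((k : ℂ) * (c - k)) =
      -c * (N * (N + 1) / 2) - (N + 1) * N * (2 * N + 1) / 6 := by
  induction N with
  | zero => simp
  | succ N ih =>
    have : Finset.Ico (-(N + 1 : ℕ) : ℤ) 0 = insert (-(N + 1) : ℤ) (Finset.Ico (-N : ℤ) 0) := by
      ext; simp only [Finset.mem_Ico, Finset.mem_insert]; omega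
    rw [this, Finset.sum_insert (by simp), ih]
    push_cast
    ring

theorem finite_support_anomaly (n : ℤ) : (Function.support (anomaly n)).Finite := by
  refine (Set.finite_Icc (min 0 n) (max 0 n)).subset fun k hk ↦ ?_
  by_contra h
  rw [Set.mem_Icc] at h
  apply hk
  unfold anomaly
  split_ifs <;> first | omega | simp

theorem finsum_anomaly (n : ℤ) : ∑ᶠ k, anomaly n k = ((n : ℂ) ^ 3 - n) / 6 := by
  obtain ⟨N, rfl | rfl⟩ := n.eq_nat_or_neg
  · have hs : Function.support (anomaly N) ⊆ (Finset.Ico (0 : ℤ) N : Finset ℤ) := fun k hk ↦ by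
      by_contra h
      rw [Finset.mem_coe, Finset.mem_Ico] at h
      apply hk
      unfold anomaly
      split_ifs <;> first | omega | simp
    rw [finsum_eq_sum_of_support_subset _ hs, Finset.sum_congr rfl fun k hk ↦ show
      anomaly N k = (k : ℂ) * (N - k) by
        rw [Finset.mem_Ico] at hk
        simp [anomaly, hk.2, hk.1.not_gt], sum_Ico_zero]
    push_cast
    ring
  · have hs : Function.support (anomaly (-N)) ⊆ (Finset.Ico (-N : ℤ) 0 : Finset ℤ) :=
      fun k hk ↦ by
      by_contra h
      rw [Finset.mem_coe, Finset.mem_Ico] at h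
      apply hk
      unfold anomaly
      split_ifs <;> first | omega | simp
    rw [finsum_eq_sum_of_support_subset _ hs, Finset.sum_congr rfl fun k hk ↦ show
      anomaly (-N) k = -((k : ℂ) * (-N - k)) by
        rw [Finset.mem_Ico] at hk
        simp [anomaly, hk.2, hk.1.not_gt], Finset.sum_neg_distrib, sum_Ico_neg_zero]
    push_cast
    ring

theorem nordSum_comm (β : ℂ) (m n : ℤ) (P : Fock) :
    nordSum β m (nordSum β n P) - nordSum β n (nordSum β m P) =
      (2 * (m - n) : ℂ) • nordSum β (m + n) P +
        (if m + n = 0 then ((m : ℂ) ^ 3 - m) / 3 else 0) • P := by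
  have hs := finite_support_nord β n P
  have hs' : (Function.support fun k ↦ nordSum β m (nord β n k P)).Finite :=
    hs.subset fun k hk h ↦ hk (by simp only [h, map_zero])
  have hsmul : ∀ c : ℤ → ℂ,
      (Function.support fun k ↦ c k • nord β (m + n) k P).Finite := fun c ↦
    (finite_support_nord β (m + n) P).subset fun k hk h ↦ hk (by simp only [h, smul_zero])
  have hshift : (Function.support fun k : ℤ ↦ (-2 * k : ℂ) • nord β (m + n) (k + m) P).Finite := by
    refine ((hsmul fun k ↦ -2 * ((k : ℂ) - m)).preimage
      (add_left_injective m).injOn).subset fun k hk ↦ ?_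
    simpa using hk
  have hanom : (Function.support fun k ↦
      (if m + n = 0 then -2 * anomaly n k else 0) • P).Finite :=
    (finite_support_anomaly n).subset fun k hk h ↦ hk (by simp [h])
  have key : nordSum β m (nordSum β n P) - nordSum β n (nordSum β m P) =
      ∑ᶠ k : ℤ, (nordSum β m (nord β n k P) - nord β n k (nordSum β m P)) := by
    rw [nordSum_apply β n, nordSum_apply β n, map_finsum _ hs,
      finsum_sub_distrib hs' (finite_support_nord β n _)]
  have hreindex : ∑ᶠ k : ℤ, (-2 * k : ℂ) • nord β (m + n) (k + m) P =
      ∑ᶠ k : ℤ, (-2 * (k - m) : ℂ) • nord β (m + n) k P := by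
    rw [← finsum_comp_equiv (Equiv.addRight m)
      (f := fun k ↦ (-2 * (k - m) : ℂ) • nord β (m + n) k P)]
    simp
  simp only [nordSum_nord] at key
  rw [finsum_add_distrib ((hsmul fun k ↦ -2 * ((n : ℂ) - k)).union hshift |>.subset
      (Function.support_add _ _)) hanom,
    finsum_add_distrib (hsmul fun k ↦ -2 * ((n : ℂ) - k)) hshift, hreindex,
    ← finsum_add_distrib (hsmul fun k ↦ -2 * ((n : ℂ) - k)) (hsmul fun k ↦ -2 * ((k : ℂ) - m)),
    ← finsum_smul] at key
  rw [key, nordSum_apply, smul_finsum]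
  congr 1
  · refine finsum_congr fun k ↦ ?_
    module
  · by_cases h : m + n = 0
    · obtain rfl : m = -n := by omega
      simp only [h, if_true]
      rw [← mul_finsum, finsum_anomaly]
      push_cast
      module
    · simp [h]

/-- the operators `L_n` satisfy the Virasoro commutation
relations with central charge `c = 1 − 3α₀²`. -/
theorem virasoro_commutation (α₀ β : ℂ) (m n : ℤ) (P : Fock) :
    virL α₀ β m (virL α₀ β n P) - virL α₀ β n (virL α₀ β m P)
      = ((m - n : ℤ) : ℂ) • virL α₀ β (m + n) P
        + (((1 - 3 * α₀ ^ 2) / 12) * ((m : ℂ) ^ 3 - (m : ℂ))) •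
            (if m + n = 0 then P else 0) := by
  have hS := nordSum_comm β m n P
  have hb := bop_comm β m n P
  rw [sub_eq_iff_eq_add] at hS
  simp only [virL_eq, map_sub, map_smul, nordSum_bop]
  rw [hS, hb, add_comm n m]
  by_cases h : m + n = 0
  · obtain rfl : n = -m := by omega
    simp only [h, if_true]
    push_cast
    module
  · simp only [h, if_false]
    push_cast
    module
end

section
/- The Fock module F_β is irreducible as a module over the Heisenberg algebra: if U ⊆ F is a ℂ-linear subspace satisfying b_n(U) ⊆ U for every n ∈ ℤ (equivalently, U is stable under multiplication by each x_n and under each partial derivative ∂/∂x_n), then U = 0 or U = F. -/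
open MvPolynomial

namespace MvPolynomial

theorem totalDegree_pderiv_lt {σ R : Type*} [CommSemiring R] {i : σ} {p : MvPolynomial σ R}
    (h : pderiv i p ≠ 0) : (pderiv i p).totalDegree < p.totalDegree := by
  have key : ∀ m ∈ (pderiv i p).support, m.degree < p.totalDegree := by
    intro m hm
    rw [mem_support_iff, coeff_pderiv] at hm
    have hp := le_totalDegree (mem_support_iff.2 (left_ne_zero_of_mul hm))
    change (m + Finsupp.single i 1).degree ≤ _ at hp
    rw [map_add, Finsupp.degree_single] at hp
    omega
  obtain ⟨m, hm⟩ := support_nonempty.2 h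
  exact (Finset.sup_lt_iff (Nat.zero_le _ |>.trans_lt (key m hm))).2 key

theorem eq_C_of_pderiv_eq_zero {σ R : Type*} [CommSemiring R] [NoZeroDivisors R] [CharZero R]
    {p : MvPolynomial σ R} (h : ∀ i, pderiv i p = 0) : p = C (coeff 0 p) := by
  classical
  ext m
  rw [coeff_C]
  split_ifs with hm
  · rw [hm]
  obtain ⟨i, hi⟩ := Finsupp.ne_iff.1 (Ne.symm hm)
  have hle : Finsupp.single i 1 ≤ m := Finsupp.single_le_iff.2 (Nat.one_le_iff_ne_zero.2 hi)
  have hc := coeff_pderiv (i := i) p (m - Finsupp.single i 1)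
  rw [h i, coeff_zero, tsub_add_cancel_of_le hle] at hc
  exact (mul_eq_zero.1 hc.symm).resolve_right (Nat.cast_add_one_ne_zero _)

/-- A nonzero subspace stable under all partial derivatives contains the constants. -/
theorem one_mem_of_pderiv_mem {σ K : Type*} [Field K] [CharZero K]
    {U : Submodule K (MvPolynomial σ K)} (hU : ∀ i, ∀ u ∈ U, pderiv i u ∈ U)
    {u : MvPolynomial σ K} (hu : u ∈ U) (h0 : u ≠ 0) : 1 ∈ U := by
  induction hd : u.totalDegree using Nat.strong_induction_on generalizing u with
  | _ d ih =>
    by_cases h : ∀ i, pderiv i u = 0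
    · obtain ⟨c, rfl⟩ : ∃ c, u = C c := ⟨_, eq_C_of_pderiv_eq_zero h⟩
      have hc : c ≠ 0 := fun hz => h0 (by rw [hz, C_0])
      have hs := U.smul_mem c⁻¹ hu
      rwa [smul_eq_C_mul, ← C_mul, inv_mul_cancel₀ hc, C_1] at hs
    · obtain ⟨i, hi⟩ := not_forall.1 h
      exact ih _ (hd ▸ totalDegree_pderiv_lt hi) (hU i u hu) hi rfl

/-- A subspace containing `1` and stable under multiplication by the variables is everything. -/
theorem eq_top_of_X_mul_mem {σ R : Type*} [CommSemiring R]
    {U : Submodule R (MvPolynomial σ R)} (hU : ∀ i, ∀ u ∈ U, X i * u ∈ U) (h1 : 1 ∈ U) :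
    U = ⊤ := by
  refine eq_top_iff.2 fun p _ => ?_
  induction p using MvPolynomial.induction_on with
  | C a => simpa [smul_eq_C_mul] using U.smul_mem a h1
  | add p q hp hq => exact U.add_mem (hp trivial) (hq trivial)
  | mul_X p i hp => exact mul_comm p (X i) ▸ hU i p (hp trivial)

end MvPolynomial

theorem bop_natCast (β : ℂ) (i : ℕ+) (u : Fock) :
    bop β (i : ℕ) u = ((i : ℕ) : ℂ) • pderiv i u := by
  have hi : (0 : ℤ) < (i : ℕ) := by exact_mod_cast i.pos
  rw [bop, dif_pos hi]
  rfl

theorem bop_neg_natCast (β : ℂ) (i : ℕ+) (u : Fock) :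
    bop β (-(i : ℕ)) u = X i * u := by
  have hi : (0 : ℤ) < (i : ℕ) := by exact_mod_cast i.pos
  rw [bop, dif_neg (by omega), dif_pos (by omega), LinearMap.mulLeft_apply]
  congr 2
  exact PNat.eq (by simp)

/-- the Fock module `F_β` is irreducible over the Heisenberg
algebra: any ℂ-linear subspace stable under all the operators `b_n`, `n ∈ ℤ`
(equivalently, under multiplication by each `x_n` and each `∂/∂x_n`), is `0`
or all of `F`. -/
theorem fock_irreducible (β : ℂ) (U : Submodule ℂ Fock)
    (hU : ∀ n : ℤ, ∀ u ∈ U, bop β n u ∈ U) :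
    U = ⊥ ∨ U = ⊤ := by
  by_cases hbot : U = ⊥
  · exact Or.inl hbot
  right
  obtain ⟨u, hu, h0⟩ := U.ne_bot_iff.1 hbot
  refine eq_top_of_X_mul_mem (fun i v hv => bop_neg_natCast β i v ▸ hU _ v hv)
    (one_mem_of_pderiv_mem (fun i v hv => ?_) hu h0)
  have hb := hU (i : ℕ) v hv
  rw [bop_natCast] at hb
  exact (U.smul_mem_iff (Nat.cast_ne_zero.2 i.ne_zero)).1 hb
end
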